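/- arXiv:2111.00259 — 5 statements merged into one kernel-verified Lean document; each statement's English description precedes it below -/
import Mathlib

section
/- If x and y are two distinct binary words of the same length n ≥ 1 that are abelian border equivalent (i.e., their abelian border arrays are equal, π_x = π_y), then y is the complement of x, that is, y[i] ≠ x[i] for every position 1 ≤ i ≤ n. -/
/-- Number of ones among positions `a, a+1, …, b-1` (0-indexed) of the binary word `x`. -/
def onesIn (x : ℕ → Bool) (a b : ℕ) : ℕ :=
  ((Finset.Ico a b).filter (fun i => x i = true)).card

/-- The length-`k` prefix of the length-`m` word `x[0..m-1]` is an abelian border of it: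
it is a proper prefix (`k < m`) whose number of ones equals that of the length-`k` suffix. -/
def IsAbelianBorder (x : ℕ → Bool) (m k : ℕ) : Prop :=
  k < m ∧ onesIn x 0 k = onesIn x (m - k) m

/-- `abArray x i` is the length of the longest abelian border of the prefix `x[0..i-1]`
(the entry `π_x[i]` of the abelian border array, in 1-indexed notation). -/
noncomputable def abArray (x : ℕ → Bool) (i : ℕ) : ℕ :=
  sSup {k | IsAbelianBorder x i k}

theorem onesIn_eq_sum (x : ℕ → Bool) (a b : ℕ) :
    onesIn x a b = ∑ i ∈ Finset.Ico a b, (x i).toNat := by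
  rw [onesIn, Finset.card_filter]
  refine Finset.sum_congr rfl fun i _ => ?_
  cases x i <;> rfl

theorem isAbelianBorder_succ_self_iff (x : ℕ → Bool) (m : ℕ) :
    IsAbelianBorder x (m + 1) m ↔ x m = x 0 := by
  have hlast := Finset.sum_Ico_succ_top (Nat.zero_le m) fun i => (x i).toNat
  have hfirst := Finset.sum_eq_sum_Ico_succ_bot (Nat.succ_pos m) fun i => (x i).toNat
  simp only [Nat.succ_eq_add_one, zero_add] at hfirst
  simp only [IsAbelianBorder, onesIn_eq_sum, Nat.lt_succ_self, true_and, Nat.add_sub_cancel_left]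
  have hinj : x m = x 0 ↔ (x m).toNat = (x 0).toNat := by
    cases x m <;> cases x 0 <;> decide
  rw [hinj]
  omega

/-- The prefix of length `m + 1` has the maximal possible entry `m` in the abelian border array
exactly when its last letter equals its first letter. -/
theorem abArray_succ_eq_iff (x : ℕ → Bool) (m : ℕ) :
    abArray x (m + 1) = m ↔ x m = x 0 := by
  rw [← isAbelianBorder_succ_self_iff]
  have hle : ∀ k ∈ {k | IsAbelianBorder x (m + 1) k}, k ≤ m := fun k hk => Nat.le_of_lt_succ hk.1
  constructor
  · intro h
    have hmem : abArray x (m + 1) ∈ {k | IsAbelianBorder x (m + 1) k} :=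
      Nat.sSup_mem ⟨0, Nat.succ_pos m, by simp [onesIn]⟩ ⟨m, hle⟩
    rwa [h] at hmem
  · intro h
    exact IsGreatest.csSup_eq ⟨h, hle⟩

/-- If two distinct binary words of the same length `n ≥ 1` have equal abelian border
arrays, then they are complements of each other. -/
theorem stmt_0 (n : ℕ) (hn : 1 ≤ n) (x y : ℕ → Bool)
    (hdist : ∃ i < n, x i ≠ y i)
    (hequiv : ∀ i, 1 ≤ i → i ≤ n → abArray x i = abArray y i) :
    ∀ i < n, y i ≠ x i := by
  have key : ∀ i < n, (x i = x 0 ↔ y i = y 0) := fun i hi => by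
    rw [← abArray_succ_eq_iff, ← abArray_succ_eq_iff, hequiv (i + 1) (by omega) (by omega)]
  obtain ⟨j, hj, hne⟩ := hdist
  have hj' := key j hj
  intro i hi
  have hi' := key i hi
  revert hj' hi' hne
  cases x 0 <;> cases y 0 <;> cases x i <;> cases y i <;> cases x j <;> cases y j <;> simp
end

section
/- Let x be a binary word of length n and let 1 ≤ i ≤ n with π_x[i] ≠ 0. Then the length of the shortest non-empty abelian border of x[1⋯i] equals i − π_x[i]. -/
theorem onesIn_add_onesIn (x : ℕ → Bool) {a b c : ℕ} (hab : a ≤ b) (hbc : b ≤ c) :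
    onesIn x a b + onesIn x b c = onesIn x a c := by
  simp only [onesIn, Finset.card_filter]
  exact Finset.sum_Ico_consecutive _ hab hbc

/-- The complement of a non-empty abelian border has the length of an abelian border. -/
theorem IsAbelianBorder.sub {x : ℕ → Bool} {m k : ℕ} (h : IsAbelianBorder x m k) (hk : 0 < k) :
    IsAbelianBorder x m (m - k) := by
  obtain ⟨hlt, heq⟩ := h
  refine ⟨by omega, ?_⟩
  have h1 := onesIn_add_onesIn x (Nat.zero_le k) hlt.le
  have h2 := onesIn_add_onesIn x (Nat.zero_le (m - k)) (Nat.sub_le m k)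
  rw [Nat.sub_sub_self hlt.le]
  omega

theorem bddAbove_setOf_isAbelianBorder (x : ℕ → Bool) (m : ℕ) :
    BddAbove {k | IsAbelianBorder x m k} :=
  ⟨m, fun _ hk => hk.1.le⟩

theorem isAbelianBorder_abArray (x : ℕ → Bool) {i : ℕ} (hi : 1 ≤ i) :
    IsAbelianBorder x i (abArray x i) :=
  Nat.sSup_mem (s := {k | IsAbelianBorder x i k}) ⟨0, hi, by simp [onesIn]⟩
    (bddAbove_setOf_isAbelianBorder x i)

theorem IsAbelianBorder.le_abArray {x : ℕ → Bool} {i k : ℕ} (h : IsAbelianBorder x i k) :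
    k ≤ abArray x i :=
  le_csSup (bddAbove_setOf_isAbelianBorder x i) h

/-- For a binary word `x` of length `n` and `1 ≤ i ≤ n` with `π_x[i] ≠ 0`, the length
of the shortest non-empty abelian border of `x[1..i]` equals `i - π_x[i]`. -/
theorem stmt_7 (n : ℕ) (x : ℕ → Bool) (i : ℕ) (h1 : 1 ≤ i) (hin : i ≤ n)
    (hne : abArray x i ≠ 0) :
    sInf {k | 0 < k ∧ IsAbelianBorder x i k} = i - abArray x i := by
  have hmax := isAbelianBorder_abArray x h1
  refine IsLeast.csInf_eq ⟨⟨Nat.sub_pos_of_lt hmax.1, hmax.sub (Nat.pos_of_ne_zero hne)⟩, ?_⟩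
  rintro k ⟨hk, hborder⟩
  have := (hborder.sub hk).le_abArray
  omega
end

section
/- Let x be a binary word of length n with x[1] = 0, let 1 < i ≤ n with x[i] = 1, and suppose x[1⋯i−1] has a non-empty abelian border with shortest such border of length k. If x[1⋯i] has a non-empty abelian border, then its shortest non-empty abelian border has length at least k. -/
theorem onesIn_succ_right (x : ℕ → Bool) {a b : ℕ} (h : a ≤ b) :
    onesIn x a (b + 1) = onesIn x a b + if x b = true then 1 else 0 := by
  simp only [onesIn, Finset.card_filter]
  exact Finset.sum_Ico_succ_top h _

theorem onesIn_eq_add_succ_left (x : ℕ → Bool) {a b : ℕ} (h : a < b) :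
    onesIn x a b = (if x a = true then 1 else 0) + onesIn x (a + 1) b := by
  simp only [onesIn, Finset.card_filter]
  exact Finset.sum_eq_sum_Ico_succ_bot h _

theorem onesIn_self (x : ℕ → Bool) (a : ℕ) : onesIn x a a = 0 := by
  simp [onesIn]

/-- If a word starts with `0` and has no non-empty abelian border of length at most `j`, then its
prefix of length `j` has fewer ones than its suffix of length `j`. -/
theorem onesIn_prefix_lt_suffix (x : ℕ → Bool) (hx : x 0 = false) {m j : ℕ} (hj : 0 < j)
    (hjm : j < m) (hno : ∀ l, 0 < l → l ≤ j → ¬ IsAbelianBorder x m l) :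
    onesIn x 0 j < onesIn x (m - j) m := by
  induction j, hj using Nat.le_induction with
  | base =>
    have hne : onesIn x 0 1 ≠ onesIn x (m - 1) m := fun h => hno 1 one_pos le_rfl ⟨hjm, h⟩
    have hzero : onesIn x 0 1 = 0 := by
      simp [onesIn_succ_right x (Nat.zero_le 0), onesIn_self, hx]
    lia
  | succ j hj ih =>
    have hlt := ih (by lia) fun l hl hlj => hno l hl (by lia)
    have hne : onesIn x 0 (j + 1) ≠ onesIn x (m - (j + 1)) m :=
      fun h => hno (j + 1) (by lia) le_rfl ⟨hjm, h⟩
    have hp := onesIn_succ_right x (Nat.zero_le j)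
    have hs := onesIn_eq_add_succ_left x (a := m - (j + 1)) (b := m) (by lia)
    rw [show m - (j + 1) + 1 = m - j by lia] at hs
    split_ifs at hp hs <;> lia

/-- Let `x` be a binary word of length `n` with `x[1] = 0`, let `1 < i ≤ n` with
`x[i] = 1`, and suppose `x[1..i-1]` has a non-empty abelian border, the shortest such
having length `k`.  If `x[1..i]` has a non-empty abelian border, then its shortest
non-empty abelian border has length at least `k`. -/
theorem stmt_10 (n : ℕ) (x : ℕ → Bool) (hx1 : x 0 = false) (i k : ℕ)
    (h1 : 1 < i) (hin : i ≤ n) (hxi : x (i - 1) = true)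
    (hk : 0 < k ∧ IsAbelianBorder x (i - 1) k)
    (hks : sInf {j | 0 < j ∧ IsAbelianBorder x (i - 1) j} = k)
    (hex : ∃ j, 0 < j ∧ IsAbelianBorder x i j) :
    k ≤ sInf {j | 0 < j ∧ IsAbelianBorder x i j} := by
  obtain ⟨m, rfl⟩ : ∃ m, i = m + 1 := ⟨i - 1, by lia⟩
  rw [Nat.add_sub_cancel] at hxi hk hks
  refine le_csInf hex ?_
  rintro j ⟨hj, -, hborder⟩
  by_contra! hjk
  have hkm : k < m := hk.2.1
  have hlt := onesIn_prefix_lt_suffix x hx1 hj (hjk.trans hkm) fun l hl hlj hb => by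
    have hle := Nat.sInf_le (s := {j | 0 < j ∧ IsAbelianBorder x m j}) ⟨hl, hb⟩
    lia
  have hs := onesIn_eq_add_succ_left x (a := m - j) (b := m) (by lia)
  have hlast := onesIn_succ_right x (a := m - j + 1) (b := m) (by lia)
  rw [show m + 1 - j = m - j + 1 by lia] at hborder
  rw [if_pos hxi] at hlast
  split_ifs at hs <;> lia
end

section
/- Let n ≥ 1 and let T_n be the number of distinct abelian border arrays of words of length n over the ternary alphabet Σ = {0, 1, 2}, i.e., the cardinality of the set { π_x : x ∈ Σ^n }. Then T_n ≤ (3^{n−1} + 1)/2. -/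
/-- Number of occurrences of the letter `c` among positions `a, a+1, …, b-1`
(0-indexed) of the word `w : Fin n → α`. -/
noncomputable def cntLetterF {α : Type*} {n : ℕ} (w : Fin n → α) (c : α) (a b : ℕ) : ℕ :=
  {i : Fin n | a ≤ i.1 ∧ i.1 < b ∧ w i = c}.ncard

/-- The length-`k` prefix of the length-`m` prefix of `w` is an abelian border of it. -/
def IsAbelianBorderF {α : Type*} {n : ℕ} (w : Fin n → α) (m k : ℕ) : Prop :=
  k < m ∧ ∀ c : α, cntLetterF w c 0 k = cntLetterF w c (m - k) m

/-- The abelian border array of the word `w : Fin n → α`: `abVecG w i` is the length of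
the longest abelian border of the prefix of length `i+1`, i.e. the entry `π_w[i+1]` in
1-indexed notation. -/
noncomputable def abVecG {α : Type*} {n : ℕ} (w : Fin n → α) : Fin n → ℕ :=
  fun i => sSup {k | IsAbelianBorderF w (i.1 + 1) k}

theorem cntLetterF_perm_comp {α : Type*} {n : ℕ} (σ : Equiv.Perm α) (w : Fin n → α) (c : α)
    (a b : ℕ) : cntLetterF (σ ∘ w) c a b = cntLetterF w (σ.symm c) a b := by
  simp only [cntLetterF, Function.comp_apply, Equiv.eq_symm_apply]

theorem isAbelianBorderF_perm_comp {α : Type*} {n : ℕ} (σ : Equiv.Perm α) (w : Fin n → α)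
    (m k : ℕ) : IsAbelianBorderF (σ ∘ w) m k ↔ IsAbelianBorderF w m k := by
  simp only [IsAbelianBorderF, cntLetterF_perm_comp]
  exact and_congr_right fun _ => σ.symm.forall_congr_left.trans (by simp)

theorem abVecG_perm_comp {α : Type*} {n : ℕ} (σ : Equiv.Perm α) (w : Fin n → α) :
    abVecG (σ ∘ w) = abVecG w := by
  funext i
  simp only [abVecG, isAbelianBorderF_perm_comp]

theorem abVecG_cons_zero_swap {m : ℕ} (y : Fin m → Fin 3) :
    abVecG (Fin.cons 0 (Equiv.swap 1 2 ∘ y) : Fin (m + 1) → Fin 3) =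
      abVecG (Fin.cons 0 y : Fin (m + 1) → Fin 3) := by
  rw [← abVecG_perm_comp (Equiv.swap 1 2) (Fin.cons 0 y : Fin (m + 1) → Fin 3)]
  congr 1
  ext i
  refine Fin.cases ?_ (fun j => ?_) i
  · simp [Equiv.swap_apply_of_ne_of_ne]
  · rfl

/-- Every abelian border array is attained by a word starting with `0`. -/
theorem exists_abVecG_cons_zero {m : ℕ} (x : Fin (m + 1) → Fin 3) :
    ∃ y : Fin m → Fin 3, abVecG (Fin.cons 0 y : Fin (m + 1) → Fin 3) = abVecG x := by
  refine ⟨Fin.tail (Equiv.swap (x 0) 0 ∘ x), ?_⟩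
  have h : (Equiv.swap (x 0) 0 ∘ x) 0 = 0 := by simp
  rw [← abVecG_perm_comp (Equiv.swap (x 0) 0) x]
  congr 1
  conv_rhs => rw [← Fin.cons_self_tail (Equiv.swap (x 0) 0 ∘ x), h]

theorem swap_one_two_comp_eq_self {m : ℕ} {y : Fin m → Fin 3}
    (h : Equiv.swap 1 2 ∘ y = y) : y = 0 := by
  have key : ∀ a : Fin 3, Equiv.swap 1 2 a = a → a = 0 := by decide
  exact funext fun i => key _ (congrFun h i)

/-- A function on a finite set that is invariant under a self-map without fixed points takes
at most half as many values as the set has elements. -/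
theorem two_mul_card_image_le {α β : Type*} [DecidableEq β] (s : Finset α)
    (f : α → β) (τ : α → α) (hτ : ∀ a ∈ s, τ a ∈ s) (hne : ∀ a ∈ s, τ a ≠ a)
    (hf : ∀ a ∈ s, f (τ a) = f a) : 2 * (s.image f).card ≤ s.card := by
  refine Finset.mul_card_image_le_card s 2 fun b hb => ?_
  obtain ⟨a, ha, rfl⟩ := Finset.mem_image.mp hb
  exact Finset.one_lt_card.mpr ⟨τ a, by simp [hτ a ha, hf a ha], a, by simp [ha], hne a ha⟩

/-- The number of distinct abelian border arrays of ternary words of length `n ≥ 1` is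
at most `(3^(n-1) + 1) / 2`. -/
theorem stmt_13 (n : ℕ) (hn : 1 ≤ n) :
    {π : Fin n → ℕ | ∃ x : Fin n → Fin 3, abVecG x = π}.ncard ≤ (3 ^ (n - 1) + 1) / 2 := by
  classical
  obtain ⟨m, rfl⟩ := Nat.exists_eq_add_of_le' hn
  let f : (Fin m → Fin 3) → Fin (m + 1) → ℕ := fun y =>
    abVecG (Fin.cons 0 y : Fin (m + 1) → Fin 3)
  let s : Finset (Fin m → Fin 3) := Finset.univ.erase 0
  have hs : s.card = 3 ^ m - 1 := by simp [s]
  have hsub : {π : Fin (m + 1) → ℕ | ∃ x : Fin (m + 1) → Fin 3, abVecG x = π} ⊆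
      (insert (f 0) (s.image f) : Finset (Fin (m + 1) → ℕ)) := by
    rintro _ ⟨x, rfl⟩
    obtain ⟨y, hy⟩ := exists_abVecG_cons_zero x
    rw [← hy]
    by_cases h : y = 0
    · simp [h, f]
    · exact Finset.mem_insert_of_mem (Finset.mem_image_of_mem f (by simp [s, h]))
  have himage : 2 * (s.image f).card ≤ s.card := by
    refine two_mul_card_image_le s f (fun y => Equiv.swap 1 2 ∘ y) (fun y hy => ?_)
      (fun y hy h => ?_) fun y _ => abVecG_cons_zero_swap y
    · simp only [s, Finset.mem_erase, Finset.mem_univ, and_true] at hy ⊢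
      refine fun h => hy (swap_one_two_comp_eq_self ?_)
      have hy' : y = Equiv.swap 1 2 ∘ (Equiv.swap 1 2 ∘ y) := by ext; simp
      rw [h] at hy'
      rw [h, hy']
      ext; simp [Equiv.swap_apply_of_ne_of_ne]
    · exact (Finset.ne_of_mem_erase hy) (swap_one_two_comp_eq_self h)
  have hcard := (Set.ncard_le_ncard hsub (Finset.finite_toSet _)).trans
    ((Set.ncard_coe_finset _).trans_le (Finset.card_insert_le _ _))
  have hpos : 0 < 3 ^ m := by positivity
  rw [Nat.add_sub_cancel]
  omega
end

section
/- Let n ≥ 2, let Σ = {0, 1, …, n−1}, and let T_n be the number of distinct abelian border arrays of words of length n over Σ, i.e., the cardinality of the set { π_x : x ∈ Σ^n }. Then T_n ≤ B_n, where B_n is the n-th Bell number (the number of partitions of an n-element set). -/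
/-- The `n`-th Bell number: the number of partitions of an `n`-element set. -/
noncomputable def bellNumber (n : ℕ) : ℕ :=
  Nat.card (Finpartition (Finset.univ : Finset (Fin n)))

/-- Being an abelian border depends only on which positions carry equal letters. -/
theorem IsAbelianBorderF.of_ker_eq {α β : Type*} {n : ℕ} {x : Fin n → α} {y : Fin n → β}
    (h : ∀ i j, x i = x j ↔ y i = y j) {m k : ℕ} (hb : IsAbelianBorderF x m k) :
    IsAbelianBorderF y m k := by
  refine ⟨hb.1, fun c => ?_⟩
  by_cases hc : ∃ i, y i = c
  · obtain ⟨i, rfl⟩ := hc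
    have := hb.2 (x i)
    simpa only [cntLetterF, h] using this
  · have hc' : ∀ i, y i ≠ c := fun i hi => hc ⟨i, hi⟩
    simp [cntLetterF, hc']

theorem abVecG_eq_of_ker_eq {α β : Type*} {n : ℕ} {x : Fin n → α} {y : Fin n → β}
    (h : ∀ i j, x i = x j ↔ y i = y j) : abVecG x = abVecG y := by
  funext i
  unfold abVecG
  congr 1
  ext k
  exact ⟨IsAbelianBorderF.of_ker_eq h, IsAbelianBorderF.of_ker_eq fun i j => (h i j).symm⟩

/-- For `n ≥ 2`, the number of distinct abelian border arrays of words of length `n`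
over the alphabet `{0, 1, …, n-1}` is at most the `n`-th Bell number. -/
theorem stmt_15 (n : ℕ) (hn : 2 ≤ n) :
    {π : Fin n → ℕ | ∃ x : Fin n → Fin n, abVecG x = π}.ncard ≤ bellNumber n := by
  classical
  rw [← Nat.card_coe_set_eq, bellNumber]
  choose x hx using fun π : {π : Fin n → ℕ | ∃ x : Fin n → Fin n, abVecG x = π} => π.2
  refine Nat.card_le_card_of_injective (fun π => Finpartition.ofSetoid (Setoid.ker (x π))) ?_
  intro π ρ hπρ
  refine Subtype.ext ?_
  rw [← hx π, ← hx ρ]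
  refine abVecG_eq_of_ker_eq fun i j => ?_
  have hmem : ∀ σ, j ∈ (Finpartition.ofSetoid (Setoid.ker (x σ))).part i ↔ x σ i = x σ j :=
    fun σ => Finpartition.mem_part_ofSetoid_iff_rel
  rw [← hmem π, ← hmem ρ]
  exact iff_of_eq (congrArg (fun P => j ∈ P.part i) hπρ)
end
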